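/- Let n ≥ 0, x ∈ G, and φ ∈ C^n(k_αG,k_αG). Then π^n_{G,x,α}(τφ) = τ·(π^n_{G,x,α}(φ)) for every τ ∈ Σ_{n+1}, where Σ_{n+1} acts on C^n(k_αG,k_αG) by the symmetric Hochschild action and on C^n(C_G(x), k x̄) by Staic's action; equivalently, π^n_{G,x,α}(σ_i φ) = σ_i(π^n_{G,x,α}(φ)) for each transposition σ_i = (i,i+1), 1 ≤ i ≤ n. -/

import Mathlib

/- Common setup: twisted group algebras modelled on their canonical basis.
An element of the twisted group algebra `k_αG` is modelled as a function `G → k`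
(its coordinates in the basis `{ḡ : g ∈ G}`), and a Hochschild `n`-cochain
`Hom_k((k_αG)^{⊗n}, M)` is modelled by its values on basis tensors, i.e. as a
function `(Fin n → G) → M`.  Similarly a group cochain `C^n(H, A)` is a function
`(Fin n → H) → A`; the one-dimensional module `k x̄` is modelled as `k` with the
action of `h` given by multiplication by the character `χ(h) = α(h,x)·α(x,h)⁻¹`. -/

namespace TwistedSym

section Defs

variable {k : Type*} [CommRing k] {G : Type*} [Group G] [DecidableEq G]
variable {M : Type*} [AddCommGroup M] [Module k M]
variable {H : Type*} [Group H]
variable {A : Type*} [AddCommGroup A] [DistribMulAction H A]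

/-- The 2-cocycle condition `α(x,yz)α(y,z) = α(xy,z)α(x,y)`. -/
def IsCocycle (α : G → G → kˣ) : Prop :=
  ∀ x y z : G, α x (y * z) * α y z = α (x * y) z * α x y

/-- Normalization `α(1,x) = α(x,1) = 1`. -/
def IsNormalized (α : G → G → kˣ) : Prop :=
  ∀ x : G, α 1 x = 1 ∧ α x 1 = 1

/-- `(L, R)` encode a `(k_αG, k_αG)`-bimodule structure on the `k`-module `M`:
`L g` is left multiplication by the basis element `ḡ` and `R g` is right
multiplication by `ḡ`. -/
def IsBimodule (α : G → G → kˣ) (L R : G → M →ₗ[k] M) : Prop :=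
  (∀ m : M, L 1 m = m) ∧ (∀ m : M, R 1 m = m) ∧
  (∀ (g h : G) (m : M), L g (L h m) = (α g h : k) • L (g * h) m) ∧
  (∀ (g h : G) (m : M), R h (R g m) = (α g h : k) • R (g * h) m) ∧
  (∀ (g h : G) (m : M), L g (R h m) = R h (L g m))

/-- The tuple of group elements appearing in the action of the transposition
`σ_{i0+1} = (i0+1, i0+2)` on `n`-cochains (0-indexed `i0 : Fin n`):
position `i0 - 1` gets `g_{i0-1}·g_{i0}`, position `i0` gets `g_{i0}⁻¹` and
position `i0 + 1` gets `g_{i0}·g_{i0+1}` (when these positions exist). -/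
def swapTuple {n : ℕ} (i0 : Fin n) (g : Fin n → H) : Fin n → H := fun j =>
  if (j : ℕ) + 1 = (i0 : ℕ) then g j * g i0
  else if j = i0 then (g i0)⁻¹
  else if (j : ℕ) = (i0 : ℕ) + 1 then g i0 * g j
  else g j

/-- The action of the transposition `σ_{i0+1} = (i0+1,i0+2) ∈ Σ_{n+1}` on Hochschild
`n`-cochains of the twisted group algebra `k_αG` with coefficients in the bimodule `M`.
All the `α`-scalars come from rewriting products and inverses of basis elements in
terms of basis elements: `ḡ·h̄ = α(g,h)·(gh)‾` and `ḡ⁻¹ = α(g,g⁻¹)⁻¹·(g⁻¹)‾`. -/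
def hSigma (α : G → G → kˣ) (L R : G → M →ₗ[k] M) {n : ℕ} (i0 : Fin n)
    (φ : (Fin n → G) → M) : (Fin n → G) → M := fun g =>
  -(((if 0 < (i0 : ℕ) then
        (α (g ⟨(i0 : ℕ) - 1, lt_of_le_of_lt (Nat.sub_le _ _) i0.isLt⟩) (g i0) : k) else 1) *
     (((α (g i0) (g i0)⁻¹)⁻¹ : kˣ) : k) *
     (if h : (i0 : ℕ) + 1 < n then (α (g i0) (g ⟨(i0 : ℕ) + 1, h⟩) : k) else 1)) •
    (if (i0 : ℕ) = 0 then
        L (g i0) (if (i0 : ℕ) + 1 = n then R (g i0) (φ (swapTuple i0 g)) else φ (swapTuple i0 g))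
      else (if (i0 : ℕ) + 1 = n then R (g i0) (φ (swapTuple i0 g)) else φ (swapTuple i0 g))))

/-- Staic's action of the transposition `σ_{i0+1} ∈ Σ_{n+1}` on group `n`-cochains
with values in an `H`-module `A`. -/
def gSigma {n : ℕ} (i0 : Fin n) (ψ : (Fin n → H) → A) : (Fin n → H) → A := fun h =>
  -(if (i0 : ℕ) = 0 then h i0 • ψ (swapTuple i0 h) else ψ (swapTuple i0 h))

/-- Staic's action of the transposition `σ_{i0+1} ∈ Σ_{n+1}` on group `n`-cochains
with values in the rank-one module `k` on which `H` acts through the character `χ`. -/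
def cSigma (χ : H → k) {n : ℕ} (i0 : Fin n) (ψ : (Fin n → H) → k) : (Fin n → H) → k := fun h =>
  -(if (i0 : ℕ) = 0 then χ (h i0) * ψ (swapTuple i0 h) else ψ (swapTuple i0 h))

/-- The `(n+1)`-tuple `g` with entries at positions `j, j+1` multiplied together. -/
def mergeAt {n : ℕ} (g : Fin (n + 1) → H) (j : Fin n) : Fin n → H := fun l =>
  if (l : ℕ) < (j : ℕ) then g (Fin.castSucc l)
  else if l = j then g (Fin.castSucc l) * g (Fin.succ l)
  else g (Fin.succ l)

/-- The Hochschild differential `δ^n` for the twisted group algebra `k_αG` with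
coefficients in the bimodule `M`, written on basis tensors (the scalar
`α(g_j, g_{j+1})` comes from `ḡ_j·ḡ_{j+1} = α(g_j,g_{j+1})·(g_jg_{j+1})‾`). -/
def hDiff (α : G → G → kˣ) (L R : G → M →ₗ[k] M) {n : ℕ}
    (φ : (Fin n → G) → M) : (Fin (n + 1) → G) → M := fun g =>
  L (g 0) (φ fun j => g j.succ)
    + ∑ j : Fin n, ((-1 : ℤ) ^ ((j : ℕ) + 1)) •
        ((α (g j.castSucc) (g j.succ) : k) • φ (mergeAt g j))
    + ((-1 : ℤ) ^ (n + 1)) • R (g (Fin.last n)) (φ fun j => g j.castSucc)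

/-- The group cohomology differential `∂^n` for cochains on `H` with values in the
`H`-module `A`. -/
def gDiff {n : ℕ} (ψ : (Fin n → H) → A) : (Fin (n + 1) → H) → A := fun h =>
  h 0 • ψ (fun j => h j.succ)
    + ∑ j : Fin n, ((-1 : ℤ) ^ ((j : ℕ) + 1)) • ψ (mergeAt h j)
    + ((-1 : ℤ) ^ (n + 1)) • ψ (fun j => h j.castSucc)

/-- The group cohomology differential `∂^n` for cochains on `H` with values in the
rank-one module `k` on which `H` acts through the character `χ`. -/
def cDiff (χ : H → k) {n : ℕ} (ψ : (Fin n → H) → k) : (Fin (n + 1) → H) → k := fun h =>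
  χ (h 0) * ψ (fun j => h j.succ)
    + ∑ j : Fin n, ((-1 : ℤ) ^ ((j : ℕ) + 1)) • ψ (mergeAt h j)
    + ((-1 : ℤ) ^ (n + 1)) • ψ (fun j => h j.castSucc)

/-- Left multiplication by the basis element `ḡ` on `k_αG` (modelled as `G → k`). -/
def Lmul (α : G → G → kˣ) (g : G) : (G → k) →ₗ[k] (G → k) where
  toFun a := fun y => (α g (g⁻¹ * y) : k) * a (g⁻¹ * y)
  map_add' a b := by funext y; simp [mul_add]
  map_smul' c a := by funext y; simp [smul_eq_mul]; ring

/-- Right multiplication by the basis element `ḡ` on `k_αG` (modelled as `G → k`). -/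
def Rmul (α : G → G → kˣ) (g : G) : (G → k) →ₗ[k] (G → k) where
  toFun a := fun y => (α (y * g⁻¹) g : k) * a (y * g⁻¹)
  map_add' a b := by funext y; simp [mul_add]
  map_smul' c a := by funext y; simp [smul_eq_mul]; ring

/-- Iterated right multiplication: `rmuls α [g₁,…,gₙ] v = v·ḡ₁·…·ḡₙ`. -/
def rmuls (α : G → G → kˣ) (l : List G) (v : G → k) : G → k :=
  l.foldl (fun w g => Rmul α g w) v

/-- Iterated right multiplication by inverses of basis elements:
`rinvs α [h₁,…,hₙ] v = v·h̄ₙ⁻¹·…·h̄₁⁻¹`, using `h̄⁻¹ = α(h,h⁻¹)⁻¹·(h⁻¹)‾`. -/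
def rinvs (α : G → G → kˣ) (l : List G) (v : G → k) : G → k :=
  l.foldr (fun h w => (((α h h⁻¹)⁻¹ : kˣ) : k) • Rmul α h⁻¹ w) v

/-- The character through which `h ∈ C_G(x)` acts on the module `k x̄`:
`χ(h) = α(h,x)·α(x,h)⁻¹`. -/
def chi (α : G → G → kˣ) (x : G) : G → k := fun h =>
  (α h x : k) * (((α x h)⁻¹ : kˣ) : k)

/-- The map `π^n_{G,x,α} : C^n(k_αG, k_αG) → C^n(C_G(x), k x̄)`: the value on
`(h₁,…,hₙ)` is the coefficient of the basis element `x̄` in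
`φ(h̄₁⊗…⊗h̄ₙ)·h̄ₙ⁻¹·…·h̄₁⁻¹` (identifying `k x̄` with `k`). -/
def piC (α : G → G → kˣ) (x : G) {n : ℕ} (φ : (Fin n → G) → (G → k)) :
    (Fin n → Subgroup.centralizer ({x} : Set G)) → k := fun h =>
  rinvs α (List.ofFn fun i => (h i : G)) (φ fun i => (h i : G)) x

/-- The same map as `piC` for a central element `x`, in which case `C_G(x) = G`:
`π^n_{G,x,α} : C^n(k_αG, k_αG) → C^n(G, k x̄)`. -/
def piZ (α : G → G → kˣ) (x : G) {n : ℕ} (φ : (Fin n → G) → (G → k)) :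
    (Fin n → G) → k := fun h =>
  rinvs α (List.ofFn h) (φ h) x

/-- The map `ν^n_{G,x,α} : C^n(G, k x̄) → C^n(k_αG, k_αG)` for `x ∈ Z(G)`:
`ψ ↦ (ḡ₁⊗…⊗ḡₙ ↦ ψ(g₁,…,gₙ)·x̄·ḡ₁·…·ḡₙ)` (identifying `k x̄` with `k`). -/
def nuZ (α : G → G → kˣ) (x : G) {n : ℕ} (ψ : (Fin n → G) → k) :
    (Fin n → G) → (G → k) := fun g =>
  ψ g • rmuls α (List.ofFn g) (Pi.single x 1)

/-- Iteration of the index map of a coset decomposition along a list of group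
elements: `chainIdx idx j [g₁,…,gᵢ]` is the index `s_j^i`. -/
def chainIdx {m : ℕ} (idx : Fin m → G → Fin m) (j : Fin m) : List G → Fin m
  | [] => j
  | a :: l => chainIdx idx (idx j a) l

/-- The map `ν^n_{G,x} : C^n(C_G(x), kx) → C^n(kG, kG)` for the (untwisted) group
algebra, relative to a right coset decomposition `G = ⋃ⱼ C_G(x)γⱼ`:
`ν(ψ)(g₁⊗…⊗gₙ) = Σⱼ ψ(h_{j,1},…,h_{j,n})·x⁻¹·xⱼ·g₁⋯gₙ` where
`xⱼ = γⱼ⁻¹xγⱼ`, the `h_{j,i} = rep (s_j^{i-1}) gᵢ ∈ C_G(x)` are determined by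
`γ_{s_j^{i-1}}·gᵢ = h_{j,i}·γ_{s_j^i}` and `kx` is identified with `k`. -/
def nuT (x : G) {m n : ℕ} (γ : Fin m → G) (idx : Fin m → G → Fin m)
    (rep : Fin m → G → G)
    (hrep : ∀ j a, rep j a ∈ Subgroup.centralizer ({x} : Set G))
    (ψ : (Fin n → Subgroup.centralizer ({x} : Set G)) → k) :
    (Fin n → G) → (G → k) := fun g =>
  ∑ j : Fin m,
    ψ (fun i => ⟨rep (chainIdx idx j ((List.ofFn g).take (i : ℕ))) (g i), hrep _ _⟩) •
      (Pi.single ((γ j)⁻¹ * x * γ j * (List.ofFn g).prod) (1 : k) : G → k)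

/-- `φ` is a Hochschild coboundary (for `n = 0` the coboundary space is `0`). -/
def IsHCoboundary (α : G → G → kˣ) (L R : G → M →ₗ[k] M) :
    ∀ {n : ℕ}, ((Fin n → G) → M) → Prop
  | 0, φ => φ = 0
  | _ + 1, φ => ∃ θ, φ = hDiff α L R θ

/-- `φ` is the Hochschild coboundary of a `Σ`-invariant cochain. -/
def IsHSCoboundary (α : G → G → kˣ) (L R : G → M →ₗ[k] M) :
    ∀ {n : ℕ}, ((Fin n → G) → M) → Prop
  | 0, φ => φ = 0
  | _ + 1, φ => ∃ θ, (∀ i0, hSigma α L R i0 θ = θ) ∧ φ = hDiff α L R θ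

/-- `ψ` is a group-cohomology coboundary (coefficients in `k` through `χ`). -/
def IsCCoboundary (χ : H → k) : ∀ {n : ℕ}, ((Fin n → H) → k) → Prop
  | 0, ψ => ψ = 0
  | _ + 1, ψ => ∃ θ, ψ = cDiff χ θ

/-- `ψ` is the coboundary of a `Σ`-invariant group cochain (coefficients through `χ`). -/
def IsCSCoboundary (χ : H → k) : ∀ {n : ℕ}, ((Fin n → H) → k) → Prop
  | 0, ψ => ψ = 0
  | _ + 1, ψ => ∃ θ, (∀ i0, cSigma χ i0 θ = θ) ∧ ψ = cDiff χ θ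

/-- `ψ` is a group-cohomology coboundary (coefficients in the `H`-module `A`). -/
def IsGCoboundary : ∀ {n : ℕ}, ((Fin n → H) → A) → Prop
  | 0, ψ => ψ = 0
  | _ + 1, ψ => ∃ θ, ψ = gDiff θ

/-- `ψ` is the coboundary of a `Σ`-invariant group cochain (coefficients in `A`). -/
def IsGSCoboundary : ∀ {n : ℕ}, ((Fin n → H) → A) → Prop
  | 0, ψ => ψ = 0
  | _ + 1, ψ => ∃ θ, (∀ i0, gSigma i0 θ = θ) ∧ ψ = gDiff θ

end Defs

section RightInverses

variable {k : Type*} [CommRing k] {G : Type*} [Group G]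

/-- Right multiplication by `ḡ⁻¹` on `k_αG`. -/
def Rinv (α : G → G → kˣ) (g : G) : (G → k) →ₗ[k] (G → k) :=
  (((α g g⁻¹)⁻¹ : kˣ) : k) • Rmul α g⁻¹

lemma rinvs_nil (α : G → G → kˣ) (v : G → k) : rinvs α [] v = v := rfl

lemma rinvs_cons (α : G → G → kˣ) (g : G) (l : List G) (v : G → k) :
    rinvs α (g :: l) v = Rinv α g (rinvs α l v) := rfl

lemma rinvs_append (α : G → G → kˣ) (l l' : List G) (v : G → k) :
    rinvs α (l ++ l') v = rinvs α l (rinvs α l' v) := by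
  simp [rinvs]

lemma rinvs_smul (α : G → G → kˣ) (l : List G) (c : k) (v : G → k) :
    rinvs α l (c • v) = c • rinvs α l v := by
  induction l with
  | nil => rfl
  | cons g l ih => rw [rinvs_cons, rinvs_cons, ih, map_smul]

lemma rinvs_neg (α : G → G → kˣ) (l : List G) (v : G → k) :
    rinvs α l (-v) = -rinvs α l v := by
  simpa using rinvs_smul α l (-1) v

lemma IsCocycle.inv_comm {α : G → G → kˣ} (hα : IsCocycle α) (hnorm : IsNormalized α) (g : G) :
    α g⁻¹ g = α g g⁻¹ := by
  simpa [(hnorm g).1, (hnorm g).2] using hα g g⁻¹ g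

lemma Rmul_one {α : G → G → kˣ} (hnorm : IsNormalized α) (v : G → k) : Rmul α 1 v = v := by
  funext y
  simp [Rmul, (hnorm y).2]

lemma Rmul_Rmul {α : G → G → kˣ} (hα : IsCocycle α) (g h : G) (v : G → k) :
    Rmul α h (Rmul α g v) = (α g h : k) • Rmul α (g * h) v := by
  funext y
  have key := congrArg (Units.val (α := k)) (hα (y * h⁻¹ * g⁻¹) g h)
  simp only [Units.val_mul, inv_mul_cancel_right] at key
  simp only [Rmul, LinearMap.coe_mk, AddHom.coe_mk, Pi.smul_apply, smul_eq_mul, mul_inv_rev,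
    ← mul_assoc]
  rw [← key]
  ring

lemma Rmul_Lmul {α : G → G → kˣ} (hα : IsCocycle α) (g h : G) (v : G → k) :
    Rmul α h (Lmul α g v) = Lmul α g (Rmul α h v) := by
  funext y
  have key := congrArg (Units.val (α := k)) (hα g (g⁻¹ * y * h⁻¹) h)
  simp only [Units.val_mul, inv_mul_cancel_right, ← mul_assoc, mul_inv_cancel, one_mul] at key
  simp only [Rmul, Lmul, LinearMap.coe_mk, AddHom.coe_mk, ← mul_assoc]
  rw [key]

lemma Rinv_Lmul {α : G → G → kˣ} (hα : IsCocycle α) (g h : G) (v : G → k) :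
    Rinv α h (Lmul α g v) = Lmul α g (Rinv α h v) := by
  simp [Rinv, Rmul_Lmul hα]

lemma rinvs_Lmul {α : G → G → kˣ} (hα : IsCocycle α) (g : G) (l : List G) (v : G → k) :
    rinvs α l (Lmul α g v) = Lmul α g (rinvs α l v) := by
  induction l with
  | nil => rfl
  | cons h l ih => simp only [rinvs_cons, ih, Rinv_Lmul hα]

lemma Rinv_Rmul {α : G → G → kˣ} (hα : IsCocycle α) (hnorm : IsNormalized α) (g : G)
    (v : G → k) : Rinv α g (Rmul α g v) = v := by
  simp [Rinv, Rmul_Rmul hα, Rmul_one hnorm, smul_smul]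

lemma Rmul_Rinv {α : G → G → kˣ} (hα : IsCocycle α) (hnorm : IsNormalized α) (g : G)
    (v : G → k) : Rmul α g (Rinv α g v) = v := by
  simp [Rinv, Rmul_Rmul hα, Rmul_one hnorm, smul_smul, hα.inv_comm hnorm]

lemma Rinv_mul {α : G → G → kˣ} (hα : IsCocycle α) (hnorm : IsNormalized α) (g h : G)
    (v : G → k) : Rinv α (g * h) v = (α g h : k) • Rinv α g (Rinv α h v) := by
  conv_lhs => rw [← Rmul_Rinv hα hnorm h v, ← Rmul_Rinv hα hnorm g (Rinv α h v)]
  rw [Rmul_Rmul hα, map_smul, Rinv_Rmul hα hnorm]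

lemma Rinv_inv {α : G → G → kˣ} (hα : IsCocycle α) (hnorm : IsNormalized α) (g : G)
    (v : G → k) : Rinv α g⁻¹ v = (((α g g⁻¹)⁻¹ : kˣ) : k) • Rmul α g v := by
  simp [Rinv, hα.inv_comm hnorm]

lemma Lmul_Rinv_apply {α : G → G → kˣ} (hα : IsCocycle α) (hnorm : IsNormalized α) {x h : G}
    (hx : h * x = x * h) (v : G → k) : Lmul α h (Rinv α h v) x = chi α x h * v x := by
  obtain ⟨w, rfl⟩ : ∃ w, v = Rmul α h w := ⟨_, (Rmul_Rinv hα hnorm h v).symm⟩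
  rw [Rinv_Rmul hα hnorm]
  have hx' : h⁻¹ * x = x * h⁻¹ := by
    rw [inv_mul_eq_iff_eq_mul, ← mul_assoc, hx, mul_inv_cancel_right]
  have key := congrArg (Units.val (α := k)) (hα h (x * h⁻¹) h)
  rw [inv_mul_cancel_right, ← hx', mul_inv_cancel_left] at key
  simp only [Units.val_mul] at key
  simp only [Lmul, Rmul, chi, LinearMap.coe_mk, AddHom.coe_mk, ← hx']
  linear_combination (-((((α x h)⁻¹ : kˣ) : k) * w (h⁻¹ * x))) * key -
    (α h (h⁻¹ * x) : k) * w (h⁻¹ * x) * (Units.inv_mul (α x h))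

end RightInverses

lemma take_ofFn_of_pos {H : Type*} {n : ℕ} (i0 : Fin n) (g : Fin n → H) (hi : 0 < (i0 : ℕ)) :
    (List.ofFn g).take i0 = (List.ofFn g).take (i0 - 1) ++
      [g ⟨i0 - 1, lt_of_le_of_lt (Nat.sub_le _ _) i0.isLt⟩] := by
  obtain ⟨m, hm⟩ : ∃ m, (i0 : ℕ) = m + 1 := ⟨i0 - 1, by omega⟩
  have : m < n := by omega
  simp only [hm, Nat.add_sub_cancel]
  rw [List.take_succ_eq_append_getElem (by simpa), List.getElem_ofFn]

lemma ofFn_eq_take_cons_drop {H : Type*} {n : ℕ} (i0 : Fin n) (g : Fin n → H) :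
    List.ofFn g = (List.ofFn g).take i0 ++ g i0 :: (List.ofFn g).drop (i0 + 1) := by
  conv_lhs => rw [← List.take_append_drop (i0 : ℕ) (List.ofFn g),
    List.drop_eq_getElem_cons (by simp), List.getElem_ofFn]

section SwapTuple

variable {H : Type*} [Group H] {n : ℕ}

lemma take_ofFn_swapTuple_of_pos (i0 : Fin n) (g : Fin n → H) (hi : 0 < (i0 : ℕ)) :
    (List.ofFn (swapTuple i0 g)).take i0 = (List.ofFn g).take (i0 - 1) ++
      [g ⟨i0 - 1, lt_of_le_of_lt (Nat.sub_le _ _) i0.isLt⟩ * g i0] := by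
  refine List.ext_getElem (by simp; omega) fun j h₁ h₂ => ?_
  have hj : j < (i0 : ℕ) := by simp at h₁; omega
  simp only [List.getElem_take, List.getElem_ofFn, List.getElem_append, swapTuple, Fin.ext_iff]
  by_cases hj' : j + 1 = (i0 : ℕ)
  · obtain rfl : j = i0 - 1 := by omega
    simp [hj']
  · have : j < (i0 : ℕ) - 1 := by omega
    rw [if_neg hj', if_neg (by omega), if_neg (by omega), dif_pos (by simp; omega)]

lemma drop_ofFn_swapTuple (i0 : Fin n) (g : Fin n → H) (hi : (i0 : ℕ) + 1 < n) :
    (List.ofFn (swapTuple i0 g)).drop (i0 + 1) =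
      (g i0 * g ⟨i0 + 1, hi⟩) :: (List.ofFn g).drop (i0 + 2) := by
  rw [List.drop_eq_getElem_cons (by simpa)]
  congr 1
  · simp only [List.getElem_ofFn, swapTuple, Fin.ext_iff]
    rw [if_neg (by omega), if_neg (by omega), if_pos trivial]
  · refine List.ext_getElem (by simp) fun j h₁ h₂ => ?_
    simp only [List.getElem_drop, List.getElem_ofFn, swapTuple, Fin.ext_iff]
    rw [if_neg (by omega), if_neg (by omega), if_neg (by omega)]

end SwapTuple

section Equivariance

variable {k : Type*} [CommRing k] {G : Type*} [Group G] {n : ℕ}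

/-- Multiplying by the inverses of the entries from position `i0` on, before and after a swap. -/
lemma rinvs_drop_swapTuple {α : G → G → kˣ} (hα : IsCocycle α) (hnorm : IsNormalized α)
    (i0 : Fin n) (g : Fin n → G) (w : G → k) :
    rinvs α ((List.ofFn (swapTuple i0 g)).drop (i0 + 1)) w =
      (if h : (i0 : ℕ) + 1 < n then (α (g i0) (g ⟨(i0 : ℕ) + 1, h⟩) : k) else 1) •
        Rinv α (g i0) (rinvs α ((List.ofFn g).drop (i0 + 1))
          (if (i0 : ℕ) + 1 = n then Rmul α (g i0) w else w)) := by
  by_cases hi : (i0 : ℕ) + 1 < n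
  · rw [dif_pos hi, if_neg hi.ne, drop_ofFn_swapTuple i0 g hi, rinvs_cons, Rinv_mul hα hnorm,
      List.drop_eq_getElem_cons (i := i0 + 1) (l := List.ofFn g) (by simpa), rinvs_cons, List.getElem_ofFn]
  · have hn : (i0 : ℕ) + 1 = n := by omega
    rw [dif_neg hi, if_pos hn, List.drop_of_length_le (by simp [hn]),
      List.drop_of_length_le (by simp [hn])]
    simp [rinvs, Rinv_Rmul hα hnorm]

/-- Multiplying by the inverses of the entries before position `i0`, before and after a swap. -/
lemma rinvs_take_swapTuple {α : G → G → kˣ} (hα : IsCocycle α) (hnorm : IsNormalized α)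
    (i0 : Fin n) (g : Fin n → G) (hi : 0 < (i0 : ℕ)) (w : G → k) :
    rinvs α ((List.ofFn (swapTuple i0 g)).take i0) w =
      (α (g ⟨(i0 : ℕ) - 1, lt_of_le_of_lt (Nat.sub_le _ _) i0.isLt⟩) (g i0) : k) •
        rinvs α ((List.ofFn g).take i0) (Rinv α (g i0) w) := by
  rw [take_ofFn_swapTuple_of_pos i0 g hi, take_ofFn_of_pos i0 g hi, rinvs_append, rinvs_append,
    rinvs_cons, rinvs_cons, Rinv_mul hα hnorm, rinvs_smul]
  rfl

lemma rinvs_hSigma_apply {α : G → G → kˣ} (hα : IsCocycle α) (hnorm : IsNormalized α) {x : G}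
    (φ : (Fin n → G) → (G → k)) (i0 : Fin n) (g : Fin n → G) (hx : g i0 * x = x * g i0) :
    rinvs α (List.ofFn g) (hSigma α (Lmul α) (Rmul α) i0 φ g) x =
      -(if (i0 : ℕ) = 0 then
          chi α x (g i0) * rinvs α (List.ofFn (swapTuple i0 g)) (φ (swapTuple i0 g)) x
        else rinvs α (List.ofFn (swapTuple i0 g)) (φ (swapTuple i0 g)) x) := by
  rw [ofFn_eq_take_cons_drop i0 (swapTuple i0 g), ofFn_eq_take_cons_drop i0 g]
  have hmid : swapTuple i0 g i0 = (g i0)⁻¹ := by simp [swapTuple]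
  simp only [hSigma, rinvs_neg, rinvs_smul, rinvs_append, rinvs_cons, hmid,
    rinvs_drop_swapTuple hα hnorm, Rinv_inv hα hnorm, map_smul, Rmul_Rinv hα hnorm]
  by_cases hi : (i0 : ℕ) = 0
  · simp only [hi, if_true, rinvs_Lmul hα]
    simp only [List.take_zero, rinvs_nil, Rinv_Lmul hα, lt_self_iff_false, if_false, one_mul,
      Pi.neg_apply, Pi.smul_apply, smul_eq_mul, Lmul_Rinv_apply hα hnorm hx]
    ring
  · have hpos : 0 < (i0 : ℕ) := by omega
    simp only [if_neg hi, if_pos hpos, rinvs_take_swapTuple hα hnorm i0 g hpos]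
    simp only [Pi.neg_apply, Pi.smul_apply, smul_eq_mul]
    ring

end Equivariance

/-- `π^n_{G,x,α}` is `Σ_{n+1}`-equivariant: it intertwines the
symmetric Hochschild action on `C^n(k_αG,k_αG)` with Staic's action on
`C^n(C_G(x), k x̄)` (it suffices to check this on the transpositions `σ_i`). -/
theorem piC_equivariant
    {k : Type*} [Field k] {G : Type*} [Group G] [Fintype G] [DecidableEq G]
    (α : G → G → kˣ) (hα : IsCocycle α) (hnorm : IsNormalized α) (x : G)
    {n : ℕ} (φ : (Fin n → G) → (G → k)) (i0 : Fin n) :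
    piC α x (hSigma α (Lmul α) (Rmul α) i0 φ) =
      cSigma (fun h : Subgroup.centralizer ({x} : Set G) => chi α x (h : G)) i0
        (piC α x φ) := by
  funext h
  have hcoe : (fun i => ((swapTuple i0 h i : Subgroup.centralizer ({x} : Set G)) : G)) = swapTuple i0 fun i => (h i : G) := by
    funext i
    simp only [swapTuple]
    split_ifs <;> rfl
  have hx : (h i0 : G) * x = x * (h i0 : G) :=
    Subgroup.mem_centralizer_singleton_iff.mp (h i0).2
  simp only [piC, cSigma, hcoe]
  exact rinvs_hSigma_apply hα hnorm φ i0 (fun i => (h i : G)) hx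

end TwistedSym
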